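/- Let (S, f) and (T, g) be lifted partial permutations on k letters. Then a domain from (S, f) to (T, g) exists if and only if S = T and f(S) = g(T). Moreover, when a domain exists, it is unique. -/

import Mathlib

open scoped Classical BigOperators

noncomputable section

/-- The group `G_m` of bijections of `ℤ` generated by the reflections
`x ↦ 1 - x` (about `1/2`) and `x ↦ 2m - 1 - x` (about `m - 1/2`). -/
def Gm (m : ℕ) : Subgroup (Equiv.Perm ℤ) :=
  Subgroup.closure {Equiv.subLeft (1 : ℤ), Equiv.subLeft (2 * (m : ℤ) - 1)}

/-- `y` lies in the `G_m`-orbit of `x`. -/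
def GmRel (m : ℕ) (x y : ℤ) : Prop := ∃ g ∈ Gm m, g x = y

/-- The `G_m`-orbit of an integer. -/
def GmOrbit (m : ℕ) (x : ℤ) : Set ℤ := {y | GmRel m x y}

/-- `(S, f)` is a lifted partial permutation on `k` letters: `S` is a
`G_m`-invariant subset of `ℤ`, `f` is `G_m`-equivariant on `S`, the quotient
`S/G_m` has exactly `k` elements, and the induced map `S/G_m → ℤ/G_m` is
injective.  (The values of `f` off `S` are irrelevant.) -/
structure IsLPP (m k : ℕ) (S : Set ℤ) (f : ℤ → ℤ) : Prop where
  invariant : ∀ g ∈ Gm m, ∀ x ∈ S, g x ∈ S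
  equivariant : ∀ g ∈ Gm m, ∀ x ∈ S, f (g x) = g (f x)
  orbits : (GmOrbit m '' S).ncard = k
  inj : ∀ x ∈ S, ∀ y ∈ S, GmRel m (f x) (f y) → GmRel m x y

/-- `(i, j)` is a crossing pair for `(S, f)`. -/
def IsCrossing (S : Set ℤ) (f : ℤ → ℤ) (i j : ℤ) : Prop :=
  i ∈ S ∧ j ∈ S ∧ i < j ∧ f j < f i

/-- The `G_m`-orbit of the unordered pair `{p.1, p.2}`; two pairs are
equivalent exactly when they have the same `pairOrbit`. -/
def pairOrbit (m : ℕ) (p : ℤ × ℤ) : Set (Set ℤ) :=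
  {A | ∃ g ∈ Gm m, A = {g p.1, g p.2}}

/-- The set of crossings of `(S, f)` (equivalence classes of crossing pairs). -/
def crossings (m : ℕ) (S : Set ℤ) (f : ℤ → ℤ) : Set (Set (Set ℤ)) :=
  pairOrbit m '' {p : ℤ × ℤ | IsCrossing S f p.1 p.2}

/-- The number of crossings `cross(f)`. -/
def crossCount (m : ℕ) (S : Set ℤ) (f : ℤ → ℤ) : ℕ := (crossings m S f).ncard

/-- The set whose cardinality (halved) is the weight `w_j(S, f)`. -/
def weightSet (j : ℤ) (S : Set ℤ) (f : ℤ → ℤ) : Set ℤ :=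
  {i | i ∈ S ∧ (((i : ℚ) < (j : ℚ) - 1/2 ∧ (j : ℚ) - 1/2 < (f i : ℚ)) ∨
    ((f i : ℚ) < (j : ℚ) - 1/2 ∧ (j : ℚ) - 1/2 < (i : ℚ)))}

/-- The weight `w_j(S, f)`. -/
def weight (j : ℤ) (S : Set ℤ) (f : ℤ → ℤ) : ℚ := (weightSet j S f).ncard / 2

/-- The resolution `f_{⟨i,j⟩}` of `f` at the crossing `⟨i, j⟩`. -/
def resolveFun (m : ℕ) (f : ℤ → ℤ) (i j : ℤ) : ℤ → ℤ := fun x =>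
  if h : ∃ g ∈ Gm m, g i = x then h.choose (f j)
  else if h' : ∃ g ∈ Gm m, g j = x then h'.choose (f i)
  else f x

/-- The graph `Γ_f = {(i, f i) : i ∈ S}`. -/
def graphOf (S : Set ℤ) (f : ℤ → ℤ) : Set (ℤ × ℤ) :=
  {p | p.1 ∈ S ∧ p.2 = f p.1}

/-- The `G_m`-orbit of a point of `ℤ × ℤ` under the diagonal action. -/
def GmOrbit2 (m : ℕ) (p : ℤ × ℤ) : Set (ℤ × ℤ) :=
  {q | ∃ g ∈ Gm m, (g p.1, g p.2) = q}

/-- The left endpoint of the image of the unit interval `[a, a+1]` under the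
affine extension of `g` to `ℝ`. -/
def sqIdx (g : Equiv.Perm ℤ) (a : ℤ) : ℤ := min (g a) (g (a + 1))

/-- The `G_m`-orbit of it the unit square indexed by `p`. -/
def sqOrbit (m : ℕ) (p : ℤ × ℤ) : Set (ℤ × ℤ) :=
  {q | ∃ g ∈ Gm m, (sqIdx g p.1, sqIdx g p.2) = q}

/-- `D` is a domain from `(S, f)` to `(T, g)`: a `G_m`-invariant assignment of
multiplicities to unit squares, nonzero on finitely many `G_m`-orbits of
squares, whose corners are governed by the two graphs. -/
def IsHDomain (m : ℕ) (S : Set ℤ) (f : ℤ → ℤ) (T : Set ℤ) (g : ℤ → ℤ)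
    (D : ℤ × ℤ → ℤ) : Prop :=
  (∀ γ ∈ Gm m, ∀ a b : ℤ, D (sqIdx γ a, sqIdx γ b) = D (a, b)) ∧
  (sqOrbit m '' {p : ℤ × ℤ | D p ≠ 0}).Finite ∧
  (∀ i j : ℤ,
    D (i, j) + D (i - 1, j - 1) - D (i, j - 1) - D (i - 1, j) =
      (if (i, j) ∈ graphOf T g then 1 else 0) -
        (if (i, j) ∈ graphOf S f then 1 else 0))


theorem mem_graphOf {S : Set ℤ} {f : ℤ → ℤ} {i j : ℤ} :
    (i, j) ∈ graphOf S f ↔ i ∈ S ∧ j = f i :=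
  Iff.rfl

theorem Gm_apply_eq {m : ℕ} {γ : Equiv.Perm ℤ} (hγ : γ ∈ Gm m) :
    (∃ t : ℤ, ∀ x, γ x = x + 2 * ((m - 1) * t)) ∨
      (∃ t : ℤ, ∀ x, γ x = 1 - x + 2 * ((m - 1) * t)) := by
  induction hγ using Subgroup.closure_induction with
  | mem x hx =>
    rcases hx with rfl | rfl
    · exact Or.inr ⟨0, fun x => by simp⟩
    · exact Or.inr ⟨1, fun x => by simp only [Equiv.subLeft_apply]; ring⟩
  | one => exact Or.inl ⟨0, fun x => by simp⟩
  | mul x y _ _ hx hy =>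
    rcases hx with ⟨s, hs⟩ | ⟨s, hs⟩ <;> rcases hy with ⟨t, ht⟩ | ⟨t, ht⟩
    · exact Or.inl ⟨s + t, fun z => by rw [Equiv.Perm.mul_apply, hs, ht]; ring⟩
    · exact Or.inr ⟨s + t, fun z => by rw [Equiv.Perm.mul_apply, hs, ht]; ring⟩
    · exact Or.inr ⟨s - t, fun z => by rw [Equiv.Perm.mul_apply, hs, ht]; ring⟩
    · exact Or.inl ⟨s - t, fun z => by rw [Equiv.Perm.mul_apply, hs, ht]; ring⟩
  | inv x _ hx =>
    rcases hx with ⟨s, hs⟩ | ⟨s, hs⟩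
    · exact Or.inl ⟨-s, fun z => by rw [Equiv.Perm.inv_eq_iff_eq, hs]; ring⟩
    · exact Or.inr ⟨s, fun z => by rw [Equiv.Perm.inv_eq_iff_eq, hs]; ring⟩

theorem subLeft_one_mem_Gm (m : ℕ) : Equiv.subLeft (1 : ℤ) ∈ Gm m :=
  Subgroup.subset_closure (Or.inl rfl)

theorem addRight_mem_Gm (m : ℕ) (t : ℤ) :
    Equiv.addRight (2 * (((m : ℤ) - 1) * t)) ∈ Gm m := by
  have h : Equiv.addRight (2 * ((m : ℤ) - 1)) ∈ Gm m := by
    have : Equiv.addRight (2 * ((m : ℤ) - 1)) =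
        Equiv.subLeft (2 * (m : ℤ) - 1) * Equiv.subLeft (1 : ℤ) := by
      ext x
      simp only [Equiv.Perm.mul_apply, Equiv.coe_addRight, Equiv.subLeft_apply]
      ring
    rw [this]
    exact mul_mem (Subgroup.subset_closure (Or.inr rfl)) (subLeft_one_mem_Gm m)
  induction t using Int.induction_on with
  | zero => simp
  | succ i ih =>
    convert mul_mem h ih using 1
    ext x
    simp only [Equiv.Perm.mul_apply, Equiv.coe_addRight]
    ring
  | pred i ih =>
    convert mul_mem (inv_mem h) ih using 1
    ext x
    rw [Equiv.Perm.mul_apply, Equiv.Perm.eq_inv_iff_eq]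
    simp only [Equiv.coe_addRight]
    ring

theorem sqIdx_of_translation {γ : Equiv.Perm ℤ} {c : ℤ} (h : ∀ x, γ x = x + c) (a : ℤ) :
    sqIdx γ a = a + c := by
  simp only [sqIdx, h]; omega

theorem sqIdx_of_reflection {γ : Equiv.Perm ℤ} {c : ℤ} (h : ∀ x, γ x = 1 - x + c) (a : ℤ) :
    sqIdx γ a = -a + c := by
  simp only [sqIdx, h]; omega

theorem abs_sqIdx_sub_sqIdx {m : ℕ} {γ : Equiv.Perm ℤ} (hγ : γ ∈ Gm m) (a b : ℤ) :
    |sqIdx γ a - sqIdx γ b| = |a - b| := by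
  rcases Gm_apply_eq hγ with ⟨t, ht⟩ | ⟨t, ht⟩
  · rw [sqIdx_of_translation ht, sqIdx_of_translation ht]; congr 1; ring
  · rw [sqIdx_of_reflection ht, sqIdx_of_reflection ht, abs_sub_comm a b]; congr 1; ring

theorem exists_translation_mem_Ico {m : ℕ} (hm : 2 ≤ m) (a : ℤ) :
    ∃ t : ℤ, a + 2 * (((m : ℤ) - 1) * t) ∈ Set.Ico (0 : ℤ) (2 * ((m : ℤ) - 1)) := by
  have hN : (0 : ℤ) < 2 * ((m : ℤ) - 1) := by omega
  refine ⟨-(a / (2 * ((m : ℤ) - 1))), ?_⟩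
  have : a + 2 * (((m : ℤ) - 1) * -(a / (2 * ((m : ℤ) - 1)))) = a % (2 * ((m : ℤ) - 1)) := by
    rw [Int.emod_def]; ring
  rw [this]
  exact ⟨Int.emod_nonneg _ hN.ne', Int.emod_lt_of_pos _ hN⟩

namespace IsLPP

variable {m k : ℕ} {S : Set ℤ} {f : ℤ → ℤ}

theorem injOn (hf : IsLPP m k S f) : Set.InjOn f S := by
  intro x hx y hy hxy
  obtain ⟨γ, hγ, rfl⟩ := hf.inj x hx y hy ⟨1, one_mem _, hxy⟩
  rw [hf.equivariant γ hγ x hx] at hxy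
  rcases Gm_apply_eq hγ with ⟨t, ht⟩ | ⟨t, ht⟩ <;> rw [ht] at hxy ⊢ <;> omega

theorem apply_mem_iff (hf : IsLPP m k S f) {γ : Equiv.Perm ℤ} (hγ : γ ∈ Gm m) {x : ℤ} :
    γ x ∈ S ↔ x ∈ S :=
  ⟨fun h => by simpa using hf.invariant γ⁻¹ (inv_mem hγ) _ h, hf.invariant γ hγ x⟩

theorem exists_abs_sub_le (hm : 2 ≤ m) (hf : IsLPP m k S f) :
    ∃ C : ℤ, ∀ i ∈ S, |f i - i| ≤ C := by
  obtain ⟨C, hC⟩ := ((Set.finite_Ico (0 : ℤ) (2 * ((m : ℤ) - 1))).image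
    (fun i => |f i - i|)).bddAbove
  refine ⟨C, fun i hi => ?_⟩
  obtain ⟨t, ht⟩ := exists_translation_mem_Ico hm i
  have h := hf.equivariant _ (addRight_mem_Gm m t) i hi
  have hle := hC (Set.mem_image_of_mem _ ht)
  simp only [Equiv.coe_addRight] at h hle
  rwa [h, add_sub_add_right_eq_sub] at hle

theorem mem_graphOf_apply (hf : IsLPP m k S f) {γ : Equiv.Perm ℤ} (hγ : γ ∈ Gm m) (i j : ℤ) :
    (γ i, γ j) ∈ graphOf S f ↔ (i, j) ∈ graphOf S f := by
  simp only [graphOf, Set.mem_ofPred_eq, hf.apply_mem_iff hγ]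
  refine and_congr_right fun hi => ?_
  rw [hf.equivariant γ hγ i hi, γ.injective.eq_iff]

theorem mem_graphOf_iff (hf : IsLPP m k S f) {j x : ℤ} (hx : j ∈ f '' S → x ∈ S ∧ f x = j)
    (i : ℤ) : (i, j) ∈ graphOf S f ↔ j ∈ f '' S ∧ i = x := by
  constructor
  · rintro ⟨hi, hj : j = f i⟩
    subst hj
    have hj : f i ∈ f '' S := ⟨i, hi, rfl⟩
    exact ⟨hj, hf.injOn hi (hx hj).1 (hx hj).2.symm⟩
  · rintro ⟨hj, rfl⟩
    exact ⟨(hx hj).1, (hx hj).2.symm⟩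

end IsLPP

/-- The corner multiplicity `1_{Γ_g} - 1_{Γ_f}` of a domain from `(S, f)` to `(T, g)`. -/
def cornerMult (S : Set ℤ) (f : ℤ → ℤ) (T : Set ℤ) (g : ℤ → ℤ) (i j : ℤ) : ℤ :=
  (if (i, j) ∈ graphOf T g then 1 else 0) - (if (i, j) ∈ graphOf S f then 1 else 0)

/-- The alternating sum of the multiplicities of `D` around the lattice point `(i, j)`. -/
def cornerSum (D : ℤ × ℤ → ℤ) (i j : ℤ) : ℤ :=
  D (i, j) + D (i - 1, j - 1) - D (i, j - 1) - D (i - 1, j)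

theorem exists_preimage_of_mem_image {S : Set ℤ} {f : ℤ → ℤ} {j : ℤ} :
    ∃ x, j ∈ f '' S → x ∈ S ∧ f x = j := by
  by_cases h : j ∈ f '' S
  · exact h.imp fun x hx _ => hx
  · exact ⟨0, fun hj => absurd hj h⟩

theorem eq_of_forall_eq_pred {P : ℤ → ℤ} (h : ∀ j, P j = P (j - 1)) (a b : ℤ) : P a = P b := by
  have key : ∀ j, P j = P 0 := fun j => by
    induction j using Int.induction_on with
    | zero => rfl
    | succ i ih => rw [h, add_sub_cancel_right, ih]
    | pred i ih => rw [← h, ih]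
  rw [key, key b]

theorem eq_const_of_cornerSum_eq_zero {D : ℤ × ℤ → ℤ} (h : ∀ i j, cornerSum D i j = 0)
    {c C : ℤ} (hc : ∀ a b, a ≤ b - C → D (a, b) = c) (a b : ℤ) : D (a, b) = c := by
  have hrow : ∀ i j j', D (i, j) - D (i - 1, j) = D (i, j') - D (i - 1, j') := fun i j j' =>
    eq_of_forall_eq_pred (P := fun j => D (i, j) - D (i - 1, j))
      (fun j => by have := h i j; simp only [cornerSum] at this; linarith) j j'
  rw [← hc (b - C) b le_rfl]
  refine eq_of_forall_eq_pred (P := fun a => D (a, b)) (fun i => ?_) a (b - C)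
  have := hrow i b (i + C)
  rw [hc i (i + C) (by omega), hc (i - 1) (i + C) (by omega), sub_self, sub_eq_zero] at this
  exact this

/-- A function with one unit up-jump (if `p`) and one unit down-jump (if `q`), vanishing near
`-∞`, is the difference of the corresponding step functions. -/
theorem eq_step_sub_step {P : ℤ → ℤ} {p q : Prop} {u v : ℤ}
    (h : ∀ j, P j - P (j - 1) = (if p ∧ j = u then 1 else 0) - (if q ∧ j = v then 1 else 0))
    {B : ℤ} (hB : ∀ j ≤ B, P j = 0) (j : ℤ) :
    P j = (if p ∧ u ≤ j then 1 else 0) - (if q ∧ v ≤ j then 1 else 0) := by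
  set R : ℤ → ℤ := fun j => P j -
    ((if p ∧ u ≤ j then 1 else 0) - (if q ∧ v ≤ j then 1 else 0)) with hR
  have hconst : ∀ j, R j = R (j - 1) := fun j => by
    have := h j
    simp only [hR]
    clear h hB
    grind (splits := 20)
  have h0 : R j = 0 := by
    rw [eq_of_forall_eq_pred hconst j (min B (min (u - 1) (v - 1)))]
    simp only [hR]
    rw [hB _ (by omega), if_neg (by omega), if_neg (by omega)]
    rfl
  exact sub_eq_zero.mp h0

theorem iff_of_jumps {P : ℤ → ℤ} {p q : Prop} {u v : ℤ}
    (h : ∀ j, P j - P (j - 1) = (if p ∧ j = u then 1 else 0) - (if q ∧ j = v then 1 else 0))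
    {A B : ℤ} (hA : ∀ j ≤ A, P j = 0) (hB : ∀ j, B ≤ j → P j = 0) : p ↔ q := by
  have := eq_step_sub_step h hA (max B (max u v))
  rw [hB _ (le_max_left _ _)] at this
  have hu : u ≤ max B (max u v) := by omega
  have hv : v ≤ max B (max u v) := by omega
  by_cases hp : p <;> by_cases hq : q <;> simp [hp, hq, hu, hv] at this ⊢

theorem IsHDomain.exists_band {m : ℕ} {S T : Set ℤ} {f g : ℤ → ℤ} {D : ℤ × ℤ → ℤ}
    (hD : IsHDomain m S f T g D) : ∃ C : ℤ, ∀ a b, C < |a - b| → D (a, b) = 0 := by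
  obtain ⟨X, -, hXbij⟩ := Set.exists_subset_bijOn {p : ℤ × ℤ | D p ≠ 0} (sqOrbit m)
  have hXfin : X.Finite := Set.Finite.of_finite_image (hXbij.image_eq ▸ hD.2.1) hXbij.injOn
  obtain ⟨C, hC⟩ := (hXfin.image fun p => |p.1 - p.2|).bddAbove
  refine ⟨C, fun a b hab => by_contra fun hne => ?_⟩
  obtain ⟨q, hq, hqo⟩ :=
    hXbij.image_eq.ge (Set.mem_image_of_mem _ (show (a, b) ∈ {p | D p ≠ 0} from hne))
  have hmem : (a, b) ∈ sqOrbit m (a, b) := ⟨1, one_mem _, by simp [sqIdx]⟩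
  rw [← hqo] at hmem
  obtain ⟨γ, hγ, he⟩ := hmem
  obtain ⟨rfl, rfl⟩ := Prod.mk.inj he
  rw [abs_sqIdx_sub_sqIdx hγ] at hab
  exact absurd (hC (Set.mem_image_of_mem _ hq)) (not_le.mpr hab)

theorem IsHDomain.unique {m : ℕ} {S T : Set ℤ} {f g : ℤ → ℤ} {D D' : ℤ × ℤ → ℤ}
    (hD : IsHDomain m S f T g D) (hD' : IsHDomain m S f T g D') : D = D' := by
  obtain ⟨C, hC⟩ := hD.exists_band
  obtain ⟨C', hC'⟩ := hD'.exists_band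
  funext ⟨a, b⟩
  refine sub_eq_zero.mp (eq_const_of_cornerSum_eq_zero (D := fun p => D p - D' p) (c := 0)
    (C := max C C' + 1) (fun i j => ?_) (fun a b hab => ?_) a b)
  · have h1 := hD.2.2 i j
    have h2 := hD'.2.2 i j
    simp only [cornerSum]
    linarith
  · have hlt : max C C' < |a - b| := lt_of_lt_of_le (by omega) (neg_le_abs (a - b))
    rw [hC a b (by omega), hC' a b (by omega), sub_zero]

theorem IsHDomain.domain_eq_and_image_eq {m k : ℕ} {S T : Set ℤ} {f g : ℤ → ℤ}
    {D : ℤ × ℤ → ℤ} (hf : IsLPP m k S f) (hg : IsLPP m k T g)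
    (hD : IsHDomain m S f T g D) : S = T ∧ f '' S = g '' T := by
  obtain ⟨C, hC⟩ := hD.exists_band
  have hC₁ : ∀ a b, C + 1 ≤ a - b → D (a, b) = 0 := fun a b h =>
    hC a b (lt_of_lt_of_le (by omega) (le_abs_self _))
  have hC₂ : ∀ a b, C + 1 ≤ b - a → D (a, b) = 0 := fun a b h =>
    hC a b (lt_of_lt_of_le (by omega) (neg_le_abs (a - b)))
  constructor
  · ext i
    refine (iff_of_jumps (P := fun j => D (i, j) - D (i - 1, j)) (u := g i) (v := f i)
      (A := i - C - 2) (B := i + C + 1) (fun j => ?_) (fun j hj => ?_) (fun j hj => ?_)).symm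
    · have h := hD.2.2 i j
      simp only [mem_graphOf] at h
      linarith
    · rw [hC₁ i j (by omega), hC₁ (i - 1) j (by omega), sub_zero]
    · rw [hC₂ i j (by omega), hC₂ (i - 1) j (by omega), sub_zero]
  · ext j
    obtain ⟨u, hu⟩ : ∃ u, j ∈ g '' T → u ∈ T ∧ g u = j := exists_preimage_of_mem_image
    obtain ⟨v, hv⟩ : ∃ v, j ∈ f '' S → v ∈ S ∧ f v = j := exists_preimage_of_mem_image
    refine (iff_of_jumps (P := fun i => D (i, j) - D (i, j - 1)) (u := u) (v := v)
      (A := j - C - 2) (B := j + C + 1) (fun i => ?_) (fun i hi => ?_) (fun i hi => ?_)).symm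
    · have h := hD.2.2 i j
      simp only [hf.mem_graphOf_iff hv, hg.mem_graphOf_iff hu] at h
      linarith
    · rw [hC₂ i j (by omega), hC₂ i (j - 1) (by omega), sub_zero]
    · rw [hC₁ i j (by omega), hC₁ i (j - 1) (by omega), sub_zero]

/-- A band-supported solution of the corner equations is a domain: its invariance follows from
the uniqueness of such solutions. -/
theorem isHDomain_of_band {m k : ℕ} (hm : 2 ≤ m) {S T : Set ℤ} {f g : ℤ → ℤ} {D : ℤ × ℤ → ℤ}
    (hf : IsLPP m k S f) (hg : IsLPP m k T g)
    (hD : ∀ i j, cornerSum D i j = cornerMult S f T g i j)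
    {C : ℤ} (hC : ∀ a b, C ≤ |a - b| → D (a, b) = 0) : IsHDomain m S f T g D := by
  have hinv : ∀ γ ∈ Gm m, ∀ a b : ℤ, D (sqIdx γ a, sqIdx γ b) = D (a, b) := by
    intro γ hγ a b
    refine sub_eq_zero.mp (eq_const_of_cornerSum_eq_zero (c := 0) (C := C)
      (D := fun p => D (sqIdx γ p.1, sqIdx γ p.2) - D p) (fun i j => ?_) (fun a b hab => ?_) a b)
    · have h1 := hD i j
      have h2 := hD (γ i) (γ j)
      simp only [cornerMult, hf.mem_graphOf_apply hγ, hg.mem_graphOf_apply hγ] at h1 h2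
      rw [← h1] at h2
      simp only [cornerSum] at h2 ⊢
      rcases Gm_apply_eq hγ with ⟨t, ht⟩ | ⟨t, ht⟩
      · simp only [sqIdx_of_translation ht, sub_add_eq_add_sub] at h2 ⊢
        simp only [ht] at h2
        linarith
      · simp only [sqIdx_of_reflection ht] at h2 ⊢
        simp only [ht] at h2
        ring_nf at h2 ⊢
        linarith
    · have hle : C ≤ |a - b| := le_trans (by omega) (neg_le_abs (a - b))
      rw [hC a b hle, hC _ _ (by rwa [abs_sqIdx_sub_sqIdx hγ]), sub_zero]
  refine ⟨hinv, ?_, hD⟩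
  refine ((((Set.finite_Ico (0 : ℤ) (2 * ((m : ℤ) - 1))).prod
    (Set.finite_Icc (-C) (2 * ((m : ℤ) - 1) + C))).image (sqOrbit m))).subset ?_
  rintro _ ⟨⟨a, b⟩, hab, rfl⟩
  obtain ⟨t, ht⟩ := exists_translation_mem_Ico hm a
  have hlt : |a - b| < C := not_le.mp fun h => hab (hC a b h)
  rw [abs_lt] at hlt
  refine ⟨(a + 2 * ((m - 1) * t), b + 2 * ((m - 1) * t)), ⟨ht, ?_⟩, ?_⟩
  · simp only [Set.mem_Ico] at ht
    exact ⟨by simp only; omega, by simp only; omega⟩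
  · set δ := Equiv.addRight (2 * (((m : ℤ) - 1) * t)) with hδ
    have hδm : δ ∈ Gm m := addRight_mem_Gm m t
    have hδx : ∀ x, δ x = x + 2 * ((m - 1) * t) := fun x => rfl
    have hδx' : ∀ x, δ⁻¹ x = x + -(2 * ((m - 1) * t)) := fun x => by
      rw [Equiv.Perm.inv_eq_iff_eq, hδx]; ring
    have hcomp : ∀ (γ : Equiv.Perm ℤ) (x : ℤ),
        sqIdx γ (x + 2 * ((m - 1) * t)) = sqIdx (γ * δ) x := fun γ x => by
      simp only [sqIdx, Equiv.Perm.mul_apply, hδx]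
      rw [add_right_comm]
    ext q
    constructor
    · rintro ⟨γ, hγ, rfl⟩
      exact ⟨γ * δ, mul_mem hγ hδm, by simp only [hcomp]⟩
    · rintro ⟨γ, hγ, rfl⟩
      exact ⟨γ * δ⁻¹, mul_mem hγ (inv_mem hδm), by simp only [hcomp, inv_mul_cancel_right]⟩

/-- The signed count of the points of `Γ_g` minus `Γ_f` in the column `i` at height at most `b`. -/
def columnCount (S : Set ℤ) (f g : ℤ → ℤ) (i b : ℤ) : ℤ :=
  (if i ∈ S ∧ g i ≤ b then 1 else 0) - (if i ∈ S ∧ f i ≤ b then 1 else 0)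

/-- The sum of the corner multiplicities over the quadrant below and to the left of `(a, b)`,
where `C` bounds the displacements of `f` and `g`. -/
def quadrantSum (S : Set ℤ) (f g : ℤ → ℤ) (C : ℤ) (p : ℤ × ℤ) : ℤ :=
  ∑ i ∈ Finset.Ioc (p.2 - C) p.1, columnCount S f g i p.2

theorem columnCount_sub_columnCount_pred (S : Set ℤ) (f g : ℤ → ℤ) (i b : ℤ) :
    columnCount S f g i b - columnCount S f g i (b - 1) = cornerMult S f S g i b := by
  simp only [columnCount, cornerMult, graphOf, Set.mem_ofPred_eq]
  by_cases hi : i ∈ S <;> simp only [hi, true_and, false_and]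
  · split_ifs <;> omega
  · simp

section QuadrantSum

variable {S : Set ℤ} {f g : ℤ → ℤ} {C : ℤ}

theorem columnCount_eq_zero_of_le (hfC : ∀ i ∈ S, |f i - i| ≤ C) (hgC : ∀ i ∈ S, |g i - i| ≤ C)
    {i b : ℤ} (h : i ≤ b - C) : columnCount S f g i b = 0 := by
  by_cases hi : i ∈ S
  · have h1 := abs_le.mp (hfC i hi)
    have h2 := abs_le.mp (hgC i hi)
    simp only [columnCount]
    rw [if_pos ⟨hi, by omega⟩, if_pos ⟨hi, by omega⟩, sub_self]
  · simp [columnCount, hi]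

theorem columnCount_eq_zero_of_lt (hfC : ∀ i ∈ S, |f i - i| ≤ C) (hgC : ∀ i ∈ S, |g i - i| ≤ C)
    {i b : ℤ} (h : b + C < i) : columnCount S f g i b = 0 := by
  by_cases hi : i ∈ S
  · have h1 := abs_le.mp (hfC i hi)
    have h2 := abs_le.mp (hgC i hi)
    simp only [columnCount]
    rw [if_neg (by omega), if_neg (by omega), sub_self]
  · simp [columnCount, hi]

theorem quadrantSum_eq_zero_of_le {a b : ℤ} (h : a ≤ b - C) : quadrantSum S f g C (a, b) = 0 := by
  simp [quadrantSum, Finset.Ioc_eq_empty_of_le h]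

theorem quadrantSum_sub_quadrantSum_pred (hfC : ∀ i ∈ S, |f i - i| ≤ C)
    (hgC : ∀ i ∈ S, |g i - i| ≤ C) (a b : ℤ) :
    quadrantSum S f g C (a, b) - quadrantSum S f g C (a - 1, b) = columnCount S f g a b := by
  rcases le_or_gt a (b - C) with h | h
  · rw [quadrantSum_eq_zero_of_le h, quadrantSum_eq_zero_of_le (by omega),
      columnCount_eq_zero_of_le hfC hgC h, sub_self]
  · have : Finset.Ioc (b - C) a = insert a (Finset.Ioc (b - C) (a - 1)) := by
      ext x; simp only [Finset.mem_Ioc, Finset.mem_insert]; omega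
    simp only [quadrantSum]
    rw [this, Finset.sum_insert (by simp), add_sub_cancel_right]

theorem cornerSum_quadrantSum (hfC : ∀ i ∈ S, |f i - i| ≤ C)
    (hgC : ∀ i ∈ S, |g i - i| ≤ C) (i j : ℤ) :
    cornerSum (quadrantSum S f g C) i j = cornerMult S f S g i j := by
  rw [← columnCount_sub_columnCount_pred, ← quadrantSum_sub_quadrantSum_pred hfC hgC,
    ← quadrantSum_sub_quadrantSum_pred hfC hgC, cornerSum]
  ring

/-- If `f` and `g` have the same image, the quadrant sum is constant far below the diagonal. -/
theorem quadrantSum_eq_of_le {m k : ℕ} (hf : IsLPP m k S f) (hg : IsLPP m k S g)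
    (him : f '' S = g '' S) (hfC : ∀ i ∈ S, |f i - i| ≤ C) (hgC : ∀ i ∈ S, |g i - i| ≤ C)
    {a b : ℤ} (hab : b + C ≤ a) :
    quadrantSum S f g C (a, b) = quadrantSum S f g C (C, 0) := by
  set Q := quadrantSum S f g C with hQ
  have hvert : ∀ a b, b + C ≤ a → Q (a, b) = Q (a, b - 1) := by
    intro a b hab
    obtain ⟨u, hu⟩ : ∃ u, b ∈ g '' S → u ∈ S ∧ g u = b := exists_preimage_of_mem_image
    obtain ⟨v, hv⟩ : ∃ v, b ∈ f '' S → v ∈ S ∧ f v = b := exists_preimage_of_mem_image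
    have := eq_step_sub_step (P := fun i => Q (i, b) - Q (i, b - 1)) (p := b ∈ g '' S)
      (q := b ∈ f '' S) (u := u) (v := v) (B := b - 1 - C) (fun i => ?_) (fun i hi => ?_) a
    · rw [← sub_eq_zero]
      refine this.trans ?_
      by_cases hb : b ∈ f '' S
      · obtain ⟨hvS, hvb⟩ := hv hb
        obtain ⟨huS, hub⟩ := hu (him ▸ hb)
        have h1 := abs_le.mp (hfC v hvS)
        have h2 := abs_le.mp (hgC u huS)
        rw [if_pos ⟨him ▸ hb, by omega⟩, if_pos ⟨hb, by omega⟩, sub_self]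
      · rw [if_neg fun h => hb (him ▸ h.1), if_neg fun h => hb h.1, sub_self]
    · have h := cornerSum_quadrantSum hfC hgC i b
      simp only [cornerSum, cornerMult, hf.mem_graphOf_iff hv, hg.mem_graphOf_iff hu] at h
      simp only [hQ]
      linarith
    · rw [hQ, quadrantSum_eq_zero_of_le (by omega), quadrantSum_eq_zero_of_le (by omega), sub_zero]
  have hdiag : ∀ d, 0 ≤ d → ∀ b, Q (b + C + d, b) = Q (C + d, 0) := fun d hd b => by
    have := eq_of_forall_eq_pred (P := fun b => Q (b + C + d, b)) (fun b => ?_) b 0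
    · simpa using this
    · rw [hvert _ b (by omega)]
      have h := quadrantSum_sub_quadrantSum_pred hfC hgC (b + C + d) (b - 1)
      rw [columnCount_eq_zero_of_lt hfC hgC (by omega), sub_eq_zero] at h
      rw [hQ, h]
      congr 2
      ring
  have hhor : Q (a, b) = Q (b + C, b) := by
    have := eq_of_forall_eq_pred (P := fun x => Q (max x (b + C), b)) (fun x => ?_) a (b + C)
    · simpa [max_eq_left hab] using this
    · rcases le_or_gt x (b + C) with h | h
      · rw [max_eq_right h, max_eq_right (by omega)]
      · rw [max_eq_left h.le, max_eq_left (by omega)]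
        have h' := quadrantSum_sub_quadrantSum_pred hfC hgC x b
        rwa [columnCount_eq_zero_of_lt hfC hgC h, sub_eq_zero] at h'
  simpa using hhor.trans (by simpa using hdiag 0 le_rfl b)

/-- If `f` and `g` have the same image, the quadrant sum vanishes far below the diagonal, by
comparison with its reflection. -/
theorem quadrantSum_eq_zero_of_ge {m k : ℕ} (hf : IsLPP m k S f) (hg : IsLPP m k S g)
    (him : f '' S = g '' S) (hfC : ∀ i ∈ S, |f i - i| ≤ C) (hgC : ∀ i ∈ S, |g i - i| ≤ C)
    {a b : ℤ} (hab : b + C ≤ a) : quadrantSum S f g C (a, b) = 0 := by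
  have hbelow : ∀ a b, b + C ≤ a → quadrantSum S f g C (a, b) = quadrantSum S f g C (C, 0) :=
    fun a b hab => quadrantSum_eq_of_le hf hg him hfC hgC hab
  set h := quadrantSum S f g C (C, 0) with hh
  have hγ := subLeft_one_mem_Gm m
  have hconst := eq_const_of_cornerSum_eq_zero (c := -h) (C := C)
    (D := fun p => quadrantSum S f g C p - quadrantSum S f g C (-p.1, -p.2)) (fun i j => ?_)
    (fun a b hab => ?_) C 0
  · simp only at hconst
    rw [← hh] at hconst
    have hle : quadrantSum S f g C (-C, -0) = 0 := quadrantSum_eq_zero_of_le (by omega)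
    rw [hbelow a b hab]
    omega
  · have h1 := cornerSum_quadrantSum hfC hgC i j
    have h2 := cornerSum_quadrantSum hfC hgC (Equiv.subLeft (1 : ℤ) i) (Equiv.subLeft (1 : ℤ) j)
    simp only [cornerMult, hf.mem_graphOf_apply hγ, hg.mem_graphOf_apply hγ] at h1 h2
    rw [← h1] at h2
    simp only [cornerSum, Equiv.subLeft_apply] at h2 ⊢
    ring_nf at h2 ⊢
    linarith
  · rw [quadrantSum_eq_zero_of_le hab, hbelow _ _ (by omega), zero_sub]

end QuadrantSum

theorem exists_isHDomain {m k : ℕ} (hm : 2 ≤ m) {S : Set ℤ} {f g : ℤ → ℤ}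
    (hf : IsLPP m k S f) (hg : IsLPP m k S g) (him : f '' S = g '' S) :
    ∃ D, IsHDomain m S f S g D := by
  obtain ⟨A, hA⟩ := hf.exists_abs_sub_le hm
  obtain ⟨B, hB⟩ := hg.exists_abs_sub_le hm
  have hfC : ∀ i ∈ S, |f i - i| ≤ max A B := fun i hi => (hA i hi).trans (le_max_left _ _)
  have hgC : ∀ i ∈ S, |g i - i| ≤ max A B := fun i hi => (hB i hi).trans (le_max_right _ _)
  refine ⟨quadrantSum S f g (max A B),
    isHDomain_of_band hm hf hg (cornerSum_quadrantSum hfC hgC) (C := max A B) fun a b hab => ?_⟩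
  rcases le_abs.mp hab with h | h
  · exact quadrantSum_eq_zero_of_ge hf hg him hfC hgC (by omega)
  · exact quadrantSum_eq_zero_of_le (by omega)

/-- A domain from `(S, f)` to `(T, g)` exists if and only if
`S = T` and `f(S) = g(T)`; moreover, when a domain exists it is unique. -/
theorem domain_exists_iff_unique (m k : ℕ) (hm : 2 ≤ m) (hk0 : 0 < k) (hkm : k < m)
    (S : Set ℤ) (f : ℤ → ℤ) (T : Set ℤ) (g : ℤ → ℤ)
    (hf : IsLPP m k S f) (hg : IsLPP m k T g) :
    ((∃ D : ℤ × ℤ → ℤ, IsHDomain m S f T g D) ↔ (S = T ∧ f '' S = g '' T)) ∧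
    (∀ D D' : ℤ × ℤ → ℤ, IsHDomain m S f T g D → IsHDomain m S f T g D' →
      D = D') := by
  refine ⟨⟨fun ⟨D, hD⟩ => hD.domain_eq_and_image_eq hf hg, ?_⟩, fun D D' hD hD' => hD.unique hD'⟩
  rintro ⟨rfl, him⟩
  exact exists_isHDomain hm hf hg him
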